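/- Let d ≥ 1, τ ∈ (0,1), fix z₀ ∈ ℝ^d, and define ẑ₁(z) = (z − (1−τ)·z₀)/τ. Let z ∈ ℝ^d, let p : ℝ^d → ℝ be differentiable at z with p(z) > 0, let L : ℝ^d → ℝ be differentiable at ẑ₁(z) with L(ẑ₁(z)) > 0, let c > 0, and set q(w) = c · p(w) · L(ẑ₁(w)). Define v_cond(z) = (1/τ)·z + ((1−τ)/τ)·∇ log q(z) and v(z) = (1/τ)·z + ((1−τ)/τ)·∇ log p(z). Then v_cond(z) = v(z) + ((1−τ)/τ²)·(∇ log L)(ẑ₁(z)). -/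

import Mathlib

/-- With `ẑ₁ z = (z - (1-τ) • z₀)/τ`, `q w = c * p w * L (ẑ₁ w)`, the conditional
velocity field `v_cond z = (1/τ) • z + ((1-τ)/τ) • ∇ log q (z)` equals the unconditional one
`v z = (1/τ) • z + ((1-τ)/τ) • ∇ log p (z)` plus `((1-τ)/τ²) • (∇ log L)(ẑ₁ z)`. -/
theorem stmt_3 (d : ℕ) (hd : 1 ≤ d) (τ : ℝ) (hτ : τ ∈ Set.Ioo (0 : ℝ) 1)
    (z₀ : EuclideanSpace ℝ (Fin d))
    (zhat : EuclideanSpace ℝ (Fin d) → EuclideanSpace ℝ (Fin d))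
    (hzhat : ∀ w, zhat w = (1 / τ) • (w - (1 - τ) • z₀))
    (z : EuclideanSpace ℝ (Fin d))
    (p L : EuclideanSpace ℝ (Fin d) → ℝ)
    (hp : DifferentiableAt ℝ p z) (hpz : 0 < p z)
    (hL : DifferentiableAt ℝ L (zhat z)) (hLz : 0 < L (zhat z))
    (c : ℝ) (hc : 0 < c)
    (q : EuclideanSpace ℝ (Fin d) → ℝ) (hq : ∀ w, q w = c * p w * L (zhat w))
    (vcond v : EuclideanSpace ℝ (Fin d))
    (hvcond : vcond = (1 / τ) • z + ((1 - τ) / τ) • gradient (fun w => Real.log (q w)) z)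
    (hv : v = (1 / τ) • z + ((1 - τ) / τ) • gradient (fun w => Real.log (p w)) z) :
    vcond = v + ((1 - τ) / τ ^ 2) • gradient (fun w => Real.log (L w)) (zhat z) := by
  have hτ0 : τ ≠ 0 := hτ.1.ne'
  have hzd : HasFDerivAt zhat
      ((1 / τ) • ContinuousLinearMap.id ℝ (EuclideanSpace ℝ (Fin d))) z := by
    rw [funext hzhat]
    exact ((hasFDerivAt_id z).sub_const _).const_smul (1 / τ)
  have hlogp : DifferentiableAt ℝ (fun w => Real.log (p w)) z := hp.log hpz.ne'
  have hlogL : DifferentiableAt ℝ (fun w => Real.log (L w)) (zhat z) := hL.log hLz.ne'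
  have hsplit : (fun w => Real.log (q w)) =ᶠ[nhds z]
      fun w => Real.log c + (Real.log (p w) + Real.log (L (zhat w))) := by
    filter_upwards [hp.continuousAt.eventually_ne hpz.ne',
      (hL.continuousAt.comp hzd.continuousAt).eventually_ne hLz.ne'] with w hpw hLw
    simp only [Function.comp_apply] at hLw
    rw [hq, Real.log_mul (mul_ne_zero hc.ne' hpw) hLw, Real.log_mul hc.ne' hpw, add_assoc]
  have hqd := ((hlogp.hasFDerivAt.add (hlogL.hasFDerivAt.comp z hzd)).const_add
    (Real.log c)).congr_of_eventuallyEq hsplit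
  have hgrad : gradient (fun w => Real.log (q w)) z = gradient (fun w => Real.log (p w)) z +
      (1 / τ) • gradient (fun w => Real.log (L w)) (zhat z) := by
    simp only [gradient]
    rw [hqd.fderiv, ContinuousLinearMap.comp_smul, ContinuousLinearMap.comp_id, map_add]
    simp
  rw [hvcond, hv, hgrad, smul_add, smul_smul, add_assoc]
  congr 3
  field_simp
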